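/- arXiv:1205.4005 — 9 statements merged into one kernel-verified Lean document; each statement's English description precedes it below -/
import Mathlib

section
/- For every ν ∈ {1,−1} and every θ ∈ ℝ, the operator R_ν(θ) on (ℂ²)^{⊗3} satisfies the generalized Yang–Baxter equation of type (2,3,1): (R_ν(θ) ⊗ I₂) ∘ (I₂ ⊗ R_ν(θ)) ∘ (R_ν(θ) ⊗ I₂) = (I₂ ⊗ R_ν(θ)) ∘ (R_ν(θ) ⊗ I₂) ∘ (I₂ ⊗ R_ν(θ)) as operators on (ℂ²)^{⊗4}, where I₂ is the identity on ℂ². -/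
/-- The generalized Yang-Baxter operator `R_ν(θ)` on `(ℂ²)^{⊗3}`, given in the
lexicographically ordered basis `e_{(i₁,i₂,i₃)}` by the block-diagonal matrix `diag(A,B)`
with `A = [[νC,0,iS,0],[0,−iS,0,C],[iS,0,νC,0],[0,C,0,−iS]]` (acting on `i₁ = 0`) and
`B = [[−iS,0,C,0],[0,νC,0,iS],[C,0,−iS,0],[0,iS,0,νC]]` (acting on `i₁ = 1`),
where `C = cos θ`, `S = sin θ`.  Equivalently: the entry at `((i₁,i₂,i₃),(j₁,j₂,j₃))`
vanishes unless `i₁ = j₁` and `i₃ = j₃`, and in the `i₂,j₂` indices it is the 2×2 block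
`[[νC,iS],[iS,νC]]` if `i₁ = i₃`, and `[[−iS,C],[C,−iS]]` if `i₁ ≠ i₃`. -/
noncomputable def gYB (ν : ℂ) (θ : ℝ) :
    Matrix (Fin 2 × Fin 2 × Fin 2) (Fin 2 × Fin 2 × Fin 2) ℂ :=
  Matrix.of fun p q =>
    if p.1 = q.1 ∧ p.2.2 = q.2.2 then
      if p.1 = p.2.2 then
        if p.2.1 = q.2.1 then ν * (Real.cos θ : ℂ) else Complex.I * (Real.sin θ : ℂ)
      else
        if p.2.1 = q.2.1 then -(Complex.I * (Real.sin θ : ℂ)) else (Real.cos θ : ℂ)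
    else 0

/-- The operator on `(ℂ^d)^{⊗n}` (matrices indexed by `Fin n → Fin d`) acting as the
three-strand operator `R` on the tensor factors at positions `p₁, p₂, p₃` and as the
identity on all other factors.  For consecutive positions `l, l+1, l+2` this is the
Kronecker product `I^{⊗l} ⊗ R ⊗ I^{⊗(n-l-3)}`. -/
noncomputable def embed3 {d n : ℕ} (p₁ p₂ p₃ : Fin n)
    (R : Matrix (Fin d × Fin d × Fin d) (Fin d × Fin d × Fin d) ℂ) :
    Matrix (Fin n → Fin d) (Fin n → Fin d) ℂ :=
  Matrix.of fun f g =>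
    (if ∀ k, k ≠ p₁ → k ≠ p₂ → k ≠ p₃ → f k = g k then 1 else 0) *
      R (f p₁, f p₂, f p₃) (g p₁, g p₂, g p₃)

/-- The diagonal entry of the block of `gYB ν θ` with outer indices `x`, `y`. -/
noncomputable def gYBDiag (ν : ℂ) (θ : ℝ) (x y : Fin 2) : ℂ :=
  if x = y then ν * (Real.cos θ : ℂ) else -(Complex.I * (Real.sin θ : ℂ))

/-- The off-diagonal entry of the block of `gYB ν θ` with outer indices `x`, `y`. -/
noncomputable def gYBOff (θ : ℝ) (x y : Fin 2) : ℂ :=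
  if x = y then Complex.I * (Real.sin θ : ℂ) else (Real.cos θ : ℂ)

theorem Fin.eq_or_eq_add_one (i j : Fin 2) : i = j ∨ i = j + 1 := by
  decide +revert

theorem embed3_left_gYB_mul_apply (ν : ℂ) (θ : ℝ)
    (M : Matrix (Fin 4 → Fin 2) (Fin 4 → Fin 2) ℂ) (x a b y : Fin 2) (g : Fin 4 → Fin 2) :
    (embed3 (0 : Fin 4) 1 2 (gYB ν θ) * M) ![x, a, b, y] g =
      gYBDiag ν θ x b * M ![x, a, b, y] g + gYBOff θ x b * M ![x, a + 1, b, y] g := by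
  rw [Matrix.mul_apply, Fintype.sum_eq_add ![x, a, b, y] ![x, a + 1, b, y]]
  · simp [embed3, gYB, gYBDiag, gYBOff, Fin.forall_fin_succ]
  · intro h
    simpa using congrFun h 1
  · rintro f ⟨h₁, h₂⟩
    have hk : (∀ k : Fin 4, k ≠ 0 → k ≠ 1 → k ≠ 2 → ![x, a, b, y] k = f k) ↔ y = f 3 := by
      simp [Fin.forall_fin_succ]
    have hf : f 1 = a ∨ f 1 = a + 1 := Fin.eq_or_eq_add_one _ _
    simp only [ne_eq, funext_iff, Fin.forall_fin_succ] at h₁ h₂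
    simp only [embed3, gYB, Matrix.of_apply, hk]
    simp at h₁ h₂ ⊢
    have hne : x = f 0 → b = f 2 → y ≠ f 3 := by
      clear hk
      grind -ring
    intro hl hr
    simp [hne hl hr]

theorem embed3_right_gYB_mul_apply (ν : ℂ) (θ : ℝ)
    (M : Matrix (Fin 4 → Fin 2) (Fin 4 → Fin 2) ℂ) (x a b y : Fin 2) (g : Fin 4 → Fin 2) :
    (embed3 (1 : Fin 4) 2 3 (gYB ν θ) * M) ![x, a, b, y] g =
      gYBDiag ν θ a y * M ![x, a, b, y] g + gYBOff θ a y * M ![x, a, b + 1, y] g := by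
  rw [Matrix.mul_apply, Fintype.sum_eq_add ![x, a, b, y] ![x, a, b + 1, y]]
  · simp [embed3, gYB, gYBDiag, gYBOff, Fin.forall_fin_succ]
  · intro h
    simpa using congrFun h 2
  · rintro f ⟨h₁, h₂⟩
    have hk : (∀ k : Fin 4, k ≠ 1 → k ≠ 2 → k ≠ 3 → ![x, a, b, y] k = f k) ↔ x = f 0 := by
      simp [Fin.forall_fin_succ]
    have hf : f 2 = b ∨ f 2 = b + 1 := Fin.eq_or_eq_add_one _ _
    simp only [ne_eq, funext_iff, Fin.forall_fin_succ] at h₁ h₂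
    simp only [embed3, gYB, Matrix.of_apply, hk]
    simp at h₁ h₂ ⊢
    have hne : a = f 1 → y = f 3 → x ≠ f 0 := by
      clear hk
      grind -ring
    intro hl hr
    simp [hne hl hr]

/-- for every `ν ∈ {1,−1}` and `θ ∈ ℝ`, the operator `R_ν(θ)` satisfies the
generalized Yang–Baxter equation of type (2,3,1):
`(R ⊗ I₂) ∘ (I₂ ⊗ R) ∘ (R ⊗ I₂) = (I₂ ⊗ R) ∘ (R ⊗ I₂) ∘ (I₂ ⊗ R)` on `(ℂ²)^{⊗4}`. -/
theorem stmt_0 (ν : ℂ) (hν : ν = 1 ∨ ν = -1) (θ : ℝ) :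
    embed3 (0 : Fin 4) 1 2 (gYB ν θ) * embed3 (1 : Fin 4) 2 3 (gYB ν θ) *
        embed3 (0 : Fin 4) 1 2 (gYB ν θ) =
      embed3 (1 : Fin 4) 2 3 (gYB ν θ) * embed3 (0 : Fin 4) 1 2 (gYB ν θ) *
        embed3 (1 : Fin 4) 2 3 (gYB ν θ) := by
  rw [Matrix.mul_assoc, Matrix.mul_assoc,
    ← Matrix.mul_one (embed3 (0 : Fin 4) 1 2 (gYB ν θ)),
    ← Matrix.mul_one (embed3 (1 : Fin 4) 2 3 (gYB ν θ))]
  simp only [Matrix.mul_assoc, Matrix.one_mul]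
  generalize (1 : Matrix (Fin 4 → Fin 2) (Fin 4 → Fin 2) ℂ) = M
  ext f g
  obtain ⟨x, a, b, y, rfl⟩ : ∃ x a b y, f = ![x, a, b, y] :=
    ⟨f 0, f 1, f 2, f 3, by ext i; fin_cases i <;> rfl⟩
  simp only [embed3_left_gYB_mul_apply, embed3_right_gYB_mul_apply]
  rcases hν with rfl | rfl <;> fin_cases x <;> fin_cases a <;> fin_cases b <;> fin_cases y <;>
    simp [gYBDiag, gYBOff] <;> ring
end

section
/- For every ν ∈ {1,−1}, every θ ∈ ℝ, and every integer j ≥ 4, the operator R_ν(θ) satisfies far-commutativity: (R_ν(θ) ⊗ I₂^{⊗(j−2)}) ∘ (I₂^{⊗(j−2)} ⊗ R_ν(θ)) = (I₂^{⊗(j−2)} ⊗ R_ν(θ)) ∘ (R_ν(θ) ⊗ I₂^{⊗(j−2)}) as operators on (ℂ²)^{⊗(j+1)}, where I₂ is the identity on ℂ². -/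
/-- The matrix on configurations `ι → κ` that only changes the value at the site `a`, from `f a` to
`y` with weight `F f y`, where `F` may depend on the whole configuration. -/
def siteMatrix {ι κ : Type*} [Fintype ι] [DecidableEq ι] [DecidableEq κ] (a : ι)
    (F : (ι → κ) → κ → ℂ) : Matrix (ι → κ) (ι → κ) ℂ :=
  Matrix.of fun f g => if ∀ k, k ≠ a → f k = g k then F f (g a) else 0

section SiteMatrix

variable {ι κ : Type*} [Fintype ι] [DecidableEq ι] [Fintype κ] [DecidableEq κ] {a b : ι}

theorem siteMatrix_mul_apply (hab : a ≠ b) (F G : (ι → κ) → κ → ℂ)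
    (hG : ∀ f x y, G (Function.update f a x) y = G f y) (f g : ι → κ) :
    (siteMatrix a F * siteMatrix b G) f g =
      if ∀ k, k ≠ a → k ≠ b → f k = g k then F f (g a) * G f (g b) else 0 := by
  rw [Matrix.mul_apply, Finset.sum_eq_single (Function.update f a (g a))]
  · have hleft : ∀ k, k ≠ a → f k = Function.update f a (g a) k := fun k hk => by simp [hk]
    have hright : (∀ k, k ≠ b → Function.update f a (g a) k = g k) ↔
        ∀ k, k ≠ a → k ≠ b → f k = g k := by
      refine ⟨fun h k hka hkb => by simpa [hka] using h k hkb, fun h k hkb => ?_⟩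
      by_cases hka : k = a
      · subst hka; simp
      · simpa [hka] using h k hka hkb
    simp only [siteMatrix, Matrix.of_apply, if_pos hleft, hright, hG, Function.update_self,
      mul_ite, mul_zero]
  · intro h _ hne
    simp only [siteMatrix, Matrix.of_apply]
    split_ifs with h₁ h₂ <;> try simp
    refine absurd (funext fun k => ?_) hne
    by_cases hka : k = a
    · subst hka; simpa using h₂ k hab
    · simpa [hka] using (h₁ k hka).symm
  · simp

theorem siteMatrix_commute (hab : a ≠ b) (F G : (ι → κ) → κ → ℂ)
    (hF : ∀ f x y, F (Function.update f b x) y = F f y)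
    (hG : ∀ f x y, G (Function.update f a x) y = G f y) :
    Commute (siteMatrix a F) (siteMatrix b G) := by
  ext f g
  rw [siteMatrix_mul_apply hab F G hG, siteMatrix_mul_apply hab.symm G F hF]
  have hswap : (∀ k, k ≠ a → k ≠ b → f k = g k) ↔ ∀ k, k ≠ b → k ≠ a → f k = g k :=
    forall_congr' fun _ => imp.swap
  simp only [hswap, mul_comm]

end SiteMatrix

theorem embed3_gYB_eq_siteMatrix {n : ℕ} {p₁ p₂ p₃ : Fin n} (h₁ : p₁ ≠ p₂) (h₃ : p₃ ≠ p₂)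
    (ν : ℂ) (θ : ℝ) :
    embed3 p₁ p₂ p₃ (gYB ν θ) =
      siteMatrix p₂ fun f y => gYB ν θ (f p₁, f p₂, f p₃) (f p₁, y, f p₃) := by
  ext f g
  simp only [embed3, siteMatrix, Matrix.of_apply]
  by_cases h : ∀ k, k ≠ p₂ → f k = g k
  · have hrest : ∀ k, k ≠ p₁ → k ≠ p₂ → k ≠ p₃ → f k = g k := fun k _ hk _ => h k hk
    rw [if_pos h, if_pos hrest, one_mul, h p₁ h₁, h p₃ h₃]
  · rw [if_neg h]
    by_cases hends : f p₁ = g p₁ ∧ f p₃ = g p₃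
    · have hrest : ¬ ∀ k, k ≠ p₁ → k ≠ p₂ → k ≠ p₃ → f k = g k := fun hr => h fun k hk => by
        by_cases hk₁ : k = p₁
        · exact hk₁ ▸ hends.1
        by_cases hk₃ : k = p₃
        · exact hk₃ ▸ hends.2
        exact hr k hk₁ hk hk₃
      rw [if_neg hrest, zero_mul]
    · simp [gYB, hends]

theorem embed3_gYB_commute {n : ℕ} {p₁ p₂ p₃ q₁ q₂ q₃ : Fin n} (hp₁ : p₁ ≠ p₂) (hp₃ : p₃ ≠ p₂)
    (hq₁ : q₁ ≠ q₂) (hq₃ : q₃ ≠ q₂) (hpq₁ : p₁ ≠ q₂) (hpq₂ : p₂ ≠ q₂) (hpq₃ : p₃ ≠ q₂)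
    (hqp₁ : q₁ ≠ p₂) (hqp₃ : q₃ ≠ p₂) (ν : ℂ) (θ : ℝ) :
    Commute (embed3 p₁ p₂ p₃ (gYB ν θ)) (embed3 q₁ q₂ q₃ (gYB ν θ)) := by
  rw [embed3_gYB_eq_siteMatrix hp₁ hp₃, embed3_gYB_eq_siteMatrix hq₁ hq₃]
  apply siteMatrix_commute hpq₂
  · intro f x y
    simp [hpq₁, hpq₂, hpq₃]
  · intro f x y
    simp [hqp₁, hpq₂.symm, hqp₃]

/-- for every `ν ∈ {1,−1}`, `θ ∈ ℝ` and integer `j ≥ 4`, far-commutativity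
holds: `(R_ν(θ) ⊗ I₂^{⊗(j−2)}) ∘ (I₂^{⊗(j−2)} ⊗ R_ν(θ)) =
(I₂^{⊗(j−2)} ⊗ R_ν(θ)) ∘ (R_ν(θ) ⊗ I₂^{⊗(j−2)})` as operators on `(ℂ²)^{⊗(j+1)}`
(the left factor acts on strands `0,1,2`, the right one on strands `j−2, j−1, j`). -/
theorem stmt_1 (ν : ℂ) (hν : ν = 1 ∨ ν = -1) (θ : ℝ) (j : ℕ) (hj : 4 ≤ j) :
    embed3 (⟨0, by omega⟩ : Fin (j + 1)) ⟨1, by omega⟩ ⟨2, by omega⟩ (gYB ν θ) *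
        embed3 (⟨j - 2, by omega⟩ : Fin (j + 1)) ⟨j - 1, by omega⟩ ⟨j, by omega⟩ (gYB ν θ) =
      embed3 (⟨j - 2, by omega⟩ : Fin (j + 1)) ⟨j - 1, by omega⟩ ⟨j, by omega⟩ (gYB ν θ) *
        embed3 (⟨0, by omega⟩ : Fin (j + 1)) ⟨1, by omega⟩ ⟨2, by omega⟩ (gYB ν θ) := by
  apply embed3_gYB_commute <;> simp only [ne_eq, Fin.mk.injEq] <;> omega
end

section
/- Fix ν ∈ {1,−1}, θ ∈ ℝ, and an integer n ≥ 3. For 1 ≤ l ≤ n−1 let R_l := I₂^{⊗(l−1)} ⊗ R_ν(θ) ⊗ I₂^{⊗(n−l−1)}, an operator on (ℂ²)^{⊗(n+1)}. Then the braid relations hold: R_l ∘ R_{l+1} ∘ R_l = R_{l+1} ∘ R_l ∘ R_{l+1} for all 1 ≤ l ≤ n−2, and R_l ∘ R_m = R_m ∘ R_l whenever |l − m| ≥ 2. (Hence σ_l ↦ R_l defines a representation of the braid group B_n on (ℂ²)^{⊗(n+1)}.) -/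
open Matrix

/-- `R_l = I₂^{⊗(l−1)} ⊗ R_ν(θ) ⊗ I₂^{⊗(n−l−1)}` on `(ℂ²)^{⊗(n+1)}`, i.e. `R_ν(θ)`
acting on the strands `l, l+1, l+2` (1-indexed; `0`-indexed positions `l−1, l, l+1`). -/
noncomputable def braidGen (ν : ℂ) (θ : ℝ) (n l : ℕ) (h1 : 1 ≤ l) (h2 : l < n) :
    Matrix (Fin (n + 1) → Fin 2) (Fin (n + 1) → Fin 2) ℂ :=
  embed3 ⟨l - 1, by omega⟩ ⟨l, by omega⟩ ⟨l + 1, by omega⟩ (gYB ν θ)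

open Function in
/-- `embed3` of a generalized Yang-Baxter operator only changes the middle strand. -/
theorem embed3_gYB_mulVec {n : ℕ} (ν : ℂ) (θ : ℝ) {o p q : Fin n} (hop : o ≠ p) (hqp : q ≠ p)
    (x : (Fin n → Fin 2) → ℂ) (f : Fin n → Fin 2) :
    (embed3 o p q (gYB ν θ) *ᵥ x) f =
      ∑ b, gYB ν θ (f o, f p, f q) (f o, b, f q) * x (update f p b) := by
  have hinj : Injective (update f p) := update_injective f p
  rw [mulVec, dotProduct, ← Finset.sum_image (s := Finset.univ) (g := update f p)
    (f := fun g => gYB ν θ (f o, f p, f q) (f o, g p, f q) * x g) hinj.injOn |>.trans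
    (Finset.sum_congr rfl fun b _ => by rw [update_self])]
  symm
  refine Finset.sum_subset_zero_on_sdiff (Finset.subset_univ _) ?_ ?_
  · intro g hg
    have hne : ¬ ∀ k, k ≠ p → f k = g k := fun h => by
      refine (Finset.mem_sdiff.1 hg).2 (Finset.mem_image.2 ⟨g p, Finset.mem_univ _, ?_⟩)
      exact (update_eq_iff.2 ⟨rfl, h⟩)
    push Not at hne
    obtain ⟨k, hkp, hk⟩ := hne
    simp only [embed3, gYB, of_apply]
    by_cases ho : f o = g o
    · by_cases hq : f q = g q
      · rw [if_neg, zero_mul, zero_mul]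
        intro h
        exact hk (h k (fun e => hk (e ▸ ho)) hkp (fun e => hk (e ▸ hq)))
      · simp [hq]
    · simp [ho]
  · intro g hg
    obtain ⟨b, -, rfl⟩ := Finset.mem_image.1 hg
    simp +contextual [embed3, update_of_ne hop, update_of_ne hqp]

open Function in
/-- Generalized Yang-Baxter operators commute when neither acts on the strands that control
the other. -/
theorem embed3_gYB_commute_s3 {n : ℕ} (ν : ℂ) (θ : ℝ) {o p q o' p' q' : Fin n}
    (hop : o ≠ p) (hqp : q ≠ p) (hop' : o' ≠ p') (hqp' : q' ≠ p')
    (hpp : p ≠ p') (h₁ : o ≠ p') (h₂ : q ≠ p') (h₃ : o' ≠ p) (h₄ : q' ≠ p) :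
    Commute (embed3 o p q (gYB ν θ)) (embed3 o' p' q' (gYB ν θ)) := by
  refine ext_iff_mulVec.2 fun x => funext fun f => ?_
  simp only [← mulVec_mulVec, embed3_gYB_mulVec ν θ hop hqp, embed3_gYB_mulVec ν θ hop' hqp',
    update_of_ne h₁, update_of_ne h₂, update_of_ne h₃, update_of_ne h₄, update_of_ne hpp,
    update_of_ne hpp.symm, Finset.mul_sum]
  rw [Finset.sum_comm]
  refine Finset.sum_congr rfl fun b _ => Finset.sum_congr rfl fun c _ => ?_
  rw [update_comm hpp, mul_left_comm]

set_option maxHeartbeats 2000000 in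
/-- The generalized Yang-Baxter equation in coordinates: `a` and `d` are the fixed outer
strands, `W b c` the coefficient of `e_{(a,b,c,d)}`. -/
theorem gYB_braid {ν : ℂ} (hν : ν = 1 ∨ ν = -1) (θ : ℝ) (a b c d : Fin 2)
    (W : Fin 2 → Fin 2 → ℂ) :
    (∑ b₁, ∑ c₁, ∑ b₂, gYB ν θ (a, b, c) (a, b₁, c) * (gYB ν θ (b₁, c, d) (b₁, c₁, d) *
        (gYB ν θ (a, b₁, c₁) (a, b₂, c₁) * W b₂ c₁))) =
      ∑ c₁, ∑ b₁, ∑ c₂, gYB ν θ (b, c, d) (b, c₁, d) * (gYB ν θ (a, b, c₁) (a, b₁, c₁) *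
        (gYB ν θ (b₁, c₁, d) (b₁, c₂, d) * W b₁ c₂)) := by
  have hu : (Complex.I * Real.sin θ) ^ 2 = (Real.cos θ : ℂ) ^ 2 - 1 := by
    have hcs : (Real.cos θ : ℂ) ^ 2 + (Real.sin θ : ℂ) ^ 2 = 1 := by
      exact_mod_cast Real.cos_sq_add_sin_sq θ
    linear_combination (Real.sin θ : ℂ) ^ 2 * Complex.I_sq - hcs
  simp only [gYB, of_apply]
  generalize (Real.cos θ : ℂ) = C at *
  generalize Complex.I * (Real.sin θ : ℂ) = u at *
  rcases hν with rfl | rfl <;> fin_cases a <;> fin_cases b <;> fin_cases c <;> fin_cases d <;>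
    simp [Fin.sum_univ_two] <;> grind

open Function in
/-- The braid relation for generalized Yang-Baxter operators on four strands `o, p, q, r`. -/
theorem embed3_gYB_braid {n : ℕ} {ν : ℂ} (hν : ν = 1 ∨ ν = -1) (θ : ℝ) {o p q r : Fin n}
    (hop : o ≠ p) (hoq : o ≠ q) (hpq : p ≠ q) (hrp : r ≠ p) (hrq : r ≠ q) :
    embed3 o p q (gYB ν θ) * embed3 p q r (gYB ν θ) * embed3 o p q (gYB ν θ) =
      embed3 p q r (gYB ν θ) * embed3 o p q (gYB ν θ) * embed3 p q r (gYB ν θ) := by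
  refine ext_iff_mulVec.2 fun x => funext fun f => ?_
  have h := gYB_braid hν θ (f o) (f p) (f q) (f r) fun b c => x (update (update f p b) q c)
  simp only [← mulVec_mulVec, embed3_gYB_mulVec ν θ hop hpq.symm, embed3_gYB_mulVec ν θ hpq hrq,
    update_of_ne hop, update_of_ne hoq, update_of_ne hpq, update_of_ne hpq.symm,
    update_of_ne hrp, update_of_ne hrq, update_self, update_comm hpq.symm, update_idem,
    Finset.mul_sum]
  exact h

/-- for `ν ∈ {1,−1}`, `θ ∈ ℝ`, `n ≥ 3`, the operators
`R_l := I₂^{⊗(l−1)} ⊗ R_ν(θ) ⊗ I₂^{⊗(n−l−1)}` on `(ℂ²)^{⊗(n+1)}` satisfy the braid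
relations: `R_l R_{l+1} R_l = R_{l+1} R_l R_{l+1}` for `1 ≤ l ≤ n−2`, and
`R_l R_m = R_m R_l` whenever `|l − m| ≥ 2` (with `1 ≤ l, m ≤ n−1`). -/
theorem stmt_3 (ν : ℂ) (hν : ν = 1 ∨ ν = -1) (θ : ℝ) (n : ℕ) (hn : 3 ≤ n) :
    (∀ l, ∀ (h1 : 1 ≤ l) (h2 : l ≤ n - 2),
        braidGen ν θ n l h1 (by omega) * braidGen ν θ n (l + 1) (by omega) (by omega) *
            braidGen ν θ n l h1 (by omega) =
          braidGen ν θ n (l + 1) (by omega) (by omega) * braidGen ν θ n l h1 (by omega) *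
            braidGen ν θ n (l + 1) (by omega) (by omega)) ∧
      (∀ l m, ∀ (hl1 : 1 ≤ l) (hl2 : l ≤ n - 1) (hm1 : 1 ≤ m) (hm2 : m ≤ n - 1),
        (l + 2 ≤ m ∨ m + 2 ≤ l) →
          braidGen ν θ n l hl1 (by omega) * braidGen ν θ n m hm1 (by omega) =
            braidGen ν θ n m hm1 (by omega) * braidGen ν θ n l hl1 (by omega)) := by
  refine ⟨fun l h1 h2 => ?_, fun l m hl1 hl2 hm1 hm2 hlm => ?_⟩
  · apply embed3_gYB_braid hν θ <;> simp only [ne_eq, Fin.mk.injEq] <;> omega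
  · apply embed3_gYB_commute_s3 ν θ <;> simp only [ne_eq, Fin.mk.injEq] <;> omega
end

section
/- Let N ≥ 5 be an odd integer and let R := −R_{+1}(π/N) on (ℂ²)^{⊗3}. Then for all i₁, i₂ ∈ {0,1}: Σ_{k∈{0,1}} R^{(i₁,i₂,k)}_{(i₁,i₂,k)} = e^{iπ(N−1)/N} and Σ_{k∈{0,1}} (R^{−1})^{(i₁,i₂,k)}_{(i₁,i₂,k)} = e^{−iπ(N−1)/N}. Equivalently, the partial trace Sp_{3,1}(R) over the third tensor factor has all entries diagonal in the second factor equal to the twist e^{iπ(N−1)/N} (and Sp_{3,1}(R^{−1}) diagonal entries equal to its inverse). -/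
open Matrix

/-- The partial trace over the third tensor factor,
`Sp_{3,1}(f)^{(j₁,j₂)}_{(i₁,i₂)} = Σ_k f^{(j₁,j₂,k)}_{(i₁,i₂,k)}`. -/
noncomputable def Sp31 (f : Matrix (Fin 2 × Fin 2 × Fin 2) (Fin 2 × Fin 2 × Fin 2) ℂ) :
    Matrix (Fin 2 × Fin 2) (Fin 2 × Fin 2) ℂ :=
  Matrix.of fun p q => ∑ k : Fin 2, f (p.1, p.2, k) (q.1, q.2, k)

/-- `R_1(-θ)` is a right inverse of `R_1(θ)`. -/
theorem gYB_one_mul_gYB_one_neg (θ : ℝ) : gYB 1 θ * gYB 1 (-θ) = 1 := by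
  have hcs : (Complex.cos θ) * Complex.cos θ + Complex.sin θ * Complex.sin θ = 1 := by
    linear_combination Complex.cos_sq_add_sin_sq (θ : ℂ)
  ext ⟨a, b, c⟩ ⟨a', b', c'⟩
  simp only [Matrix.mul_apply, Fintype.sum_prod_type, Fin.sum_univ_two, gYB, Matrix.of_apply,
    Matrix.one_apply]
  fin_cases a <;> fin_cases b <;> fin_cases c <;> fin_cases a' <;> fin_cases b' <;>
    fin_cases c' <;> simp <;> first
    | ring1
    | linear_combination hcs - Complex.sin θ * Complex.sin θ * Complex.I_mul_I

theorem sum_gYB_one_diag (θ : ℝ) (i₁ i₂ : Fin 2) :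
    ∑ k : Fin 2, gYB 1 θ (i₁, i₂, k) (i₁, i₂, k) = Complex.exp (-θ * Complex.I) := by
  rw [Complex.exp_mul_I, Complex.cos_neg, Complex.sin_neg]
  fin_cases i₁ <;> simp [gYB, Fin.sum_univ_two] <;> ring

/-- for odd `N ≥ 5` and `R := −R_{+1}(π/N)`, for all `i₁, i₂ ∈ {0,1}`:
`Σ_k R^{(i₁,i₂,k)}_{(i₁,i₂,k)} = e^{iπ(N−1)/N}` and
`Σ_k (R⁻¹)^{(i₁,i₂,k)}_{(i₁,i₂,k)} = e^{−iπ(N−1)/N}`; equivalently the partial trace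
`Sp_{3,1}(R)` has all entries diagonal in the second factor equal to the twist
`e^{iπ(N−1)/N}`, and `Sp_{3,1}(R⁻¹)` those equal to its inverse. -/
theorem stmt_6 (N : ℕ) (hN : 5 ≤ N) (hodd : Odd N) (i₁ i₂ : Fin 2) :
    (∑ k : Fin 2, (-gYB 1 (Real.pi / N)) (i₁, i₂, k) (i₁, i₂, k) =
        Complex.exp (Real.pi * ((N : ℂ) - 1) / N * Complex.I)) ∧
      (∑ k : Fin 2, (-gYB 1 (Real.pi / N))⁻¹ (i₁, i₂, k) (i₁, i₂, k) =
        Complex.exp (-(Real.pi * ((N : ℂ) - 1) / N) * Complex.I)) ∧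
      Sp31 (-gYB 1 (Real.pi / N)) (i₁, i₂) (i₁, i₂) =
        Complex.exp (Real.pi * ((N : ℂ) - 1) / N * Complex.I) ∧
      Sp31 ((-gYB 1 (Real.pi / N))⁻¹) (i₁, i₂) (i₁, i₂) =
        Complex.exp (-(Real.pi * ((N : ℂ) - 1) / N) * Complex.I) := by
  have hN0 : (N : ℂ) ≠ 0 := Nat.cast_ne_zero.mpr (by omega)
  have hR : ∑ k : Fin 2, (-gYB 1 (Real.pi / N)) (i₁, i₂, k) (i₁, i₂, k) =
      Complex.exp (Real.pi * ((N : ℂ) - 1) / N * Complex.I) := by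
    have harg : (Real.pi * ((N : ℂ) - 1) / N * Complex.I) =
        -((Real.pi / N : ℝ) : ℂ) * Complex.I + Real.pi * Complex.I := by
      push_cast
      field_simp
      ring
    simp only [Matrix.neg_apply, Finset.sum_neg_distrib]
    rw [sum_gYB_one_diag, harg, Complex.exp_add, Complex.exp_pi_mul_I, mul_neg_one]
  have hRinv : ∑ k : Fin 2, (-gYB 1 (Real.pi / N))⁻¹ (i₁, i₂, k) (i₁, i₂, k) =
      Complex.exp (-(Real.pi * ((N : ℂ) - 1) / N) * Complex.I) := by
    have harg : (-(Real.pi * ((N : ℂ) - 1) / N) * Complex.I) =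
        -((-(Real.pi / N) : ℝ) : ℂ) * Complex.I - Real.pi * Complex.I := by
      push_cast
      field_simp
      ring
    have hinv : (-gYB 1 (Real.pi / N))⁻¹ = -gYB 1 (-(Real.pi / N)) :=
      Matrix.inv_eq_right_inv (by rw [neg_mul_neg, gYB_one_mul_gYB_one_neg])
    simp only [hinv, Matrix.neg_apply, Finset.sum_neg_distrib]
    rw [sum_gYB_one_diag, harg, Complex.exp_sub, Complex.exp_pi_mul_I, div_neg, div_one]
  exact ⟨hR, hRinv, hR, hRinv⟩
end

section
/- Let N ≥ 5 be an odd integer and let R := −R_{+1}(π/N) on (ℂ²)^{⊗3} ≅ ℂ⁸. Then R satisfies the cubic minimal-polynomial identity R³ + e^{−iπ/N} R² − e^{2iπ/N} R − e^{iπ/N} I₈ = 0. -/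
open Matrix

/-- The matrix on `(ℂ²)^{⊗3}` which is diagonal in the outer indices and acts on the middle index
by `[[a,b],[b,a]]` when the outer indices agree and by `[[c,d],[d,c]]` when they differ. -/
def controlledBlock (a b c d : ℂ) : Matrix (Fin 2 × Fin 2 × Fin 2) (Fin 2 × Fin 2 × Fin 2) ℂ :=
  Matrix.of fun p q =>
    if p.1 = q.1 ∧ p.2.2 = q.2.2 then
      if p.1 = p.2.2 then
        if p.2.1 = q.2.1 then a else b
      else
        if p.2.1 = q.2.1 then c else d
    else 0

theorem controlledBlock_mul (a b c d a' b' c' d' : ℂ) :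
    controlledBlock a b c d * controlledBlock a' b' c' d' =
      controlledBlock (a * a' + b * b') (a * b' + b * a') (c * c' + d * d') (c * d' + d * c') := by
  ext ⟨i, j, k⟩ ⟨i', j', k'⟩
  simp only [controlledBlock, Matrix.mul_apply, Matrix.of_apply, Fintype.sum_prod_type,
    Fin.sum_univ_two]
  fin_cases i <;> fin_cases j <;> fin_cases k <;> fin_cases i' <;> fin_cases j' <;>
    fin_cases k' <;> simp [add_comm]

theorem controlledBlock_add (a b c d a' b' c' d' : ℂ) :
    controlledBlock a b c d + controlledBlock a' b' c' d' =
      controlledBlock (a + a') (b + b') (c + c') (d + d') := by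
  ext p q
  simp only [controlledBlock, Matrix.add_apply, Matrix.of_apply]
  split_ifs <;> simp

theorem neg_controlledBlock (a b c d : ℂ) :
    -controlledBlock a b c d = controlledBlock (-a) (-b) (-c) (-d) := by
  ext p q
  simp only [controlledBlock, Matrix.neg_apply, Matrix.of_apply]
  split_ifs <;> simp

theorem smul_controlledBlock (r a b c d : ℂ) :
    r • controlledBlock a b c d = controlledBlock (r * a) (r * b) (r * c) (r * d) := by
  ext p q
  simp only [controlledBlock, Matrix.smul_apply, Matrix.of_apply, smul_eq_mul]
  split_ifs <;> simp

theorem controlledBlock_one : controlledBlock 1 0 1 0 = 1 := by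
  ext ⟨i, j, k⟩ ⟨i', j', k'⟩
  by_cases hi : i = i' <;> by_cases hj : j = j' <;> by_cases hk : k = k' <;>
    simp [controlledBlock, Matrix.one_apply, hi, hj, hk]

theorem controlledBlock_zero : controlledBlock 0 0 0 0 = 0 := by
  ext p q
  simp [controlledBlock]

theorem gYB_eq_controlledBlock (ν : ℂ) (θ : ℝ) :
    gYB ν θ = controlledBlock (ν * Complex.cos θ) (Complex.I * Complex.sin θ)
      (-(Complex.I * Complex.sin θ)) (Complex.cos θ) := by
  simp only [gYB, controlledBlock, Complex.ofReal_cos, Complex.ofReal_sin]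

theorem neg_gYB_one_cubic (θ : ℝ) :
    (-gYB 1 θ) ^ 3 + Complex.exp (-(θ : ℂ) * Complex.I) • (-gYB 1 θ) ^ 2
      - Complex.exp (2 * (θ : ℂ) * Complex.I) • (-gYB 1 θ)
      - Complex.exp ((θ : ℂ) * Complex.I) •
          (1 : Matrix (Fin 2 × Fin 2 × Fin 2) (Fin 2 × Fin 2 × Fin 2) ℂ) = 0 := by
  have hsq : Complex.exp (2 * (θ : ℂ) * Complex.I) = Complex.exp ((θ : ℂ) * Complex.I) ^ 2 := by
    rw [← Complex.exp_nat_mul]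
    push_cast
    ring_nf
  have hinv : Complex.exp ((θ : ℂ) * Complex.I) * Complex.exp (-(θ : ℂ) * Complex.I) = 1 := by
    rw [← Complex.exp_add]
    simp
  have hcos : Complex.cos θ =
      (Complex.exp ((θ : ℂ) * Complex.I) + Complex.exp (-(θ : ℂ) * Complex.I)) / 2 := rfl
  have hsin : Complex.I * Complex.sin θ =
      (Complex.exp ((θ : ℂ) * Complex.I) - Complex.exp (-(θ : ℂ) * Complex.I)) / 2 := by
    rw [Complex.sin]
    linear_combination (Complex.exp (-(θ : ℂ) * Complex.I) - Complex.exp ((θ : ℂ) * Complex.I)) / 2 *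
      Complex.I_mul_I
  rw [gYB_eq_controlledBlock, hsin, hcos, hsq]
  generalize Complex.exp ((θ : ℂ) * Complex.I) = e at *
  generalize Complex.exp (-(θ : ℂ) * Complex.I) = f at *
  simp only [pow_succ, pow_zero, one_mul, ← controlledBlock_one, ← controlledBlock_zero,
    neg_controlledBlock, smul_controlledBlock, controlledBlock_mul, controlledBlock_add,
    sub_eq_add_neg (controlledBlock _ _ _ _)]
  congr 1
  · linear_combination e * hinv
  · ring
  · linear_combination e * hinv
  · ring

/-- for odd `N ≥ 5`, the operator `R := −R_{+1}(π/N)` satisfies the cubic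
minimal-polynomial identity `R³ + e^{−iπ/N} R² − e^{2iπ/N} R − e^{iπ/N} I₈ = 0`. -/
theorem stmt_7 (N : ℕ) (hN : 5 ≤ N) (hodd : Odd N) :
    (-gYB 1 (Real.pi / N)) ^ 3
        + Complex.exp (-(Real.pi / N : ℂ) * Complex.I) • (-gYB 1 (Real.pi / N)) ^ 2
        - Complex.exp (2 * (Real.pi / N : ℂ) * Complex.I) • (-gYB 1 (Real.pi / N))
        - Complex.exp ((Real.pi / N : ℂ) * Complex.I) •
            (1 : Matrix (Fin 2 × Fin 2 × Fin 2) (Fin 2 × Fin 2 × Fin 2) ℂ) = 0 := by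
  simpa only [Complex.ofReal_div, Complex.ofReal_natCast] using
    neg_gYB_one_cubic (Real.pi / N)
end

section
/- Let N ≥ 5 be an odd integer. The characteristic polynomial of the 8×8 matrix −R_{+1}(π/N) is (x + e^{iπ/N})² (x − e^{iπ/N})² (x + e^{−iπ/N})⁴; that is, its eigenvalues are −e^{iπ/N} with multiplicity 2, e^{iπ/N} with multiplicity 2, and −e^{−iπ/N} with multiplicity 4. In particular −R_{+1}(π/N) has exactly three distinct eigenvalues. -/
open Matrix

theorem Matrix.charpoly_blockDiagonal {n o R : Type*} [Fintype n] [DecidableEq n] [Fintype o]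
    [DecidableEq o] [CommRing R] (M : o → Matrix n n R) :
    (Matrix.blockDiagonal M).charpoly = ∏ k, (M k).charpoly := by
  have h : (Matrix.blockDiagonal M).charmatrix
      = Matrix.blockDiagonal fun k => (M k).charmatrix := by
    ext ⟨i, k⟩ ⟨j, l⟩
    by_cases hkl : k = l <;> by_cases hij : i = j <;>
      simp [Matrix.blockDiagonal_apply, hkl, hij]
  simp only [Matrix.charpoly, h, Matrix.det_blockDiagonal]

/-- The `2 × 2` block of `gYB ν θ` acting on the middle tensor factor, indexed by the outer pair
`(i₁, i₃)`. -/
noncomputable def gYBBlock (ν : ℂ) (θ : ℝ) (k : Fin 2 × Fin 2) : Matrix (Fin 2) (Fin 2) ℂ :=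
  if k.1 = k.2 then
    !![ν * (Real.cos θ : ℂ), Complex.I * (Real.sin θ : ℂ);
      Complex.I * (Real.sin θ : ℂ), ν * (Real.cos θ : ℂ)]
  else
    !![-(Complex.I * (Real.sin θ : ℂ)), (Real.cos θ : ℂ);
      (Real.cos θ : ℂ), -(Complex.I * (Real.sin θ : ℂ))]

/-- Moves the middle tensor index to the front. -/
def middleFirst : Fin 2 × Fin 2 × Fin 2 ≃ Fin 2 × (Fin 2 × Fin 2) where
  toFun p := (p.2.1, (p.1, p.2.2))
  invFun p := (p.2.1, p.1, p.2.2)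
  left_inv _ := rfl
  right_inv _ := rfl

theorem reindex_neg_gYB (ν : ℂ) (θ : ℝ) :
    Matrix.reindex middleFirst middleFirst (-gYB ν θ)
      = Matrix.blockDiagonal fun k => -gYBBlock ν θ k := by
  ext ⟨i, k, l⟩ ⟨j, k', l'⟩
  by_cases h : k = k' ∧ l = l'
  · obtain ⟨rfl, rfl⟩ := h
    by_cases hkl : k = l <;> fin_cases i <;> fin_cases j <;>
      simp [gYB, gYBBlock, middleFirst, Matrix.blockDiagonal_apply, hkl]
  · simp [gYB, middleFirst, Matrix.blockDiagonal_apply, h]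

open Polynomial in
theorem charpoly_neg_symm_circulant_two (a b : ℂ) :
    (-!![a, b; b, a]).charpoly = (X + C (a + b)) * (X + C (a - b)) := by
  rw [Matrix.charpoly_fin_two]
  simp [Matrix.trace_fin_two, Matrix.det_fin_two]
  ring

open Polynomial in
theorem charpoly_neg_gYB_one (θ : ℝ) :
    (-gYB 1 θ).charpoly =
      (X + C (Complex.exp (θ * Complex.I))) ^ 2 * (X - C (Complex.exp (θ * Complex.I))) ^ 2 *
        (X + C (Complex.exp (-θ * Complex.I))) ^ 4 := by
  rw [← Matrix.charpoly_reindex middleFirst, reindex_neg_gYB, Matrix.charpoly_blockDiagonal]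
  simp only [Fintype.prod_prod_type, Fin.prod_univ_two, gYBBlock, if_true, zero_ne_one,
    one_ne_zero, if_false, charpoly_neg_symm_circulant_two, Complex.exp_mul_I, Complex.cos_neg,
    Complex.sin_neg, Complex.ofReal_cos, Complex.ofReal_sin, C_add, C_sub, C_neg, C_mul, C_1]
  ring

theorem exp_ne_neg_exp_neg {z : ℂ} (hz : Complex.cos z ≠ 0) :
    Complex.exp (z * Complex.I) ≠ -Complex.exp (-z * Complex.I) := by
  intro h
  rw [Complex.exp_mul_I, Complex.exp_mul_I, Complex.cos_neg, Complex.sin_neg] at h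
  exact hz (by linear_combination h / 2)

theorem exp_ne_exp_neg {z : ℂ} (hz : Complex.sin z ≠ 0) :
    Complex.exp (z * Complex.I) ≠ Complex.exp (-z * Complex.I) := by
  intro h
  rw [Complex.exp_mul_I, Complex.exp_mul_I, Complex.cos_neg, Complex.sin_neg] at h
  exact hz (by linear_combination -Complex.I * h / 2 + Complex.sin z * Complex.I_sq)

theorem ncard_spectrum_neg_gYB_one {θ : ℝ} (hc : Real.cos θ ≠ 0) (hs : Real.sin θ ≠ 0) :
    (spectrum ℂ (-gYB 1 θ)).ncard = 3 := by
  have hc' : Complex.cos θ ≠ 0 := by exact_mod_cast hc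
  have hs' : Complex.sin θ ≠ 0 := by exact_mod_cast hs
  have h : spectrum ℂ (-gYB 1 θ) = {-Complex.exp (θ * Complex.I), Complex.exp (θ * Complex.I),
      -Complex.exp (-θ * Complex.I)} := by
    ext x
    rw [Matrix.mem_spectrum_iff_isRoot_charpoly, charpoly_neg_gYB_one]
    simp [sub_eq_zero, add_eq_zero_iff_eq_neg, or_assoc]
  rw [h, Set.ncard_eq_three]
  exact ⟨_, _, _, neg_ne_self.mpr (Complex.exp_ne_zero _), neg_injective.ne (exp_ne_exp_neg hs'),
    exp_ne_neg_exp_neg hc', rfl⟩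

open Polynomial in
/-- for odd `N ≥ 5`, the characteristic polynomial of the 8×8 matrix
`−R_{+1}(π/N)` is `(x + e^{iπ/N})² (x − e^{iπ/N})² (x + e^{−iπ/N})⁴`; in particular
it has exactly three distinct eigenvalues. -/
theorem stmt_8 (N : ℕ) (hN : 5 ≤ N) (hodd : Odd N) :
    (-gYB 1 (Real.pi / N)).charpoly =
        (X + C (Complex.exp ((Real.pi / N : ℂ) * Complex.I))) ^ 2 *
          (X - C (Complex.exp ((Real.pi / N : ℂ) * Complex.I))) ^ 2 *
          (X + C (Complex.exp (-(Real.pi / N : ℂ) * Complex.I))) ^ 4 ∧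
      (spectrum ℂ (-gYB 1 (Real.pi / N))).ncard = 3 := by
  have hN' : (5 : ℝ) ≤ N := by exact_mod_cast hN
  have hpos : 0 < Real.pi / N := by positivity
  have hlt : Real.pi / N < Real.pi / 2 :=
    div_lt_div_of_pos_left Real.pi_pos two_pos (by linarith)
  refine ⟨?_, ncard_spectrum_neg_gYB_one
    (Real.cos_pos_of_mem_Ioo ⟨by linarith, hlt⟩).ne'
    (Real.sin_pos_of_pos_of_lt_pi hpos (by linarith [Real.pi_pos])).ne'⟩
  simpa using charpoly_neg_gYB_one (Real.pi / N)
end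

section
/- Let N ≥ 5 be an odd integer, let R := −R_{+1}(π/N) on (ℂ²)^{⊗3} ≅ ℂ⁸, and define E := I₈ − (2i sin(π/N))^{−1}(R − R^{−1}), so that the skein identity R − R^{−1} = 2i sin(π/N)(I₈ − E) holds by construction. Then E² = 2E and R ∘ E = −e^{iπ/N} E. (E is twice the projection onto the trivial fusion channel, corresponding to the morphism f_𝟏 with f_𝟏² = 2 f_𝟏 = dim(X₁) f_𝟏 and eigenvalue R^{X₁,X₁}_𝟏 = −e^{iπ/N}.) -/
open Matrix

/-- The matrix with entry `1` exactly where `i₁ = j₁ = i₃ = j₃`: the all-ones `2×2` block on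
each subspace `i₁ = i₃` and zero elsewhere, i.e. twice the projection onto the trivial channel. -/
def trivialChannel : Matrix (Fin 2 × Fin 2 × Fin 2) (Fin 2 × Fin 2 × Fin 2) ℂ :=
  Matrix.of fun p q => if p.1 = q.1 ∧ p.2.2 = q.2.2 ∧ p.1 = p.2.2 then 1 else 0

theorem trivialChannel_mul_self : trivialChannel * trivialChannel = (2 : ℂ) • trivialChannel := by
  ext ⟨a, b, c⟩ ⟨a', b', c'⟩
  fin_cases a <;> fin_cases c <;> fin_cases a' <;> fin_cases c' <;>
    simp [trivialChannel, Matrix.mul_apply, Fintype.sum_prod_type, Fin.sum_univ_two]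

theorem gYB_mul_gYB_neg {ν : ℂ} (hν : ν ^ 2 = 1) (θ : ℝ) : gYB ν θ * gYB ν (-θ) = 1 := by
  have h := Complex.sin_sq_add_cos_sq (θ : ℂ)
  ext ⟨a, b, c⟩ ⟨a', b', c'⟩
  fin_cases a <;> fin_cases b <;> fin_cases c <;> fin_cases a' <;> fin_cases b' <;> fin_cases c' <;>
    simp [gYB, Matrix.mul_apply, Fintype.sum_prod_type, Fin.sum_univ_two] <;>
    grind [Complex.I_sq]

theorem gYB_sub_gYB_neg (ν : ℂ) (θ : ℝ) :
    gYB ν θ - gYB ν (-θ) = (2 * Complex.I * (Real.sin θ : ℂ)) • (trivialChannel - 1) := by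
  ext ⟨a, b, c⟩ ⟨a', b', c'⟩
  fin_cases a <;> fin_cases b <;> fin_cases c <;> fin_cases a' <;> fin_cases b' <;> fin_cases c' <;>
    simp [gYB, trivialChannel] <;> ring

theorem gYB_one_mul_trivialChannel (θ : ℝ) :
    gYB 1 θ * trivialChannel = Complex.exp (θ * Complex.I) • trivialChannel := by
  rw [Complex.exp_mul_I]
  ext ⟨a, b, c⟩ ⟨a', b', c'⟩
  fin_cases a <;> fin_cases b <;> fin_cases c <;> fin_cases a' <;> fin_cases c' <;>
    simp [gYB, trivialChannel, Matrix.mul_apply, Fintype.sum_prod_type, Fin.sum_univ_two] <;> ring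

/-- for odd `N ≥ 5`, `R := −R_{+1}(π/N)` and
`E := I₈ − (2i sin(π/N))⁻¹ (R − R⁻¹)` (so that the skein identity
`R − R⁻¹ = 2i sin(π/N)(I₈ − E)` holds by construction), one has
`E² = 2E` and `R ∘ E = −e^{iπ/N} E`. -/
theorem stmt_9 (N : ℕ) (hN : 5 ≤ N) (hodd : Odd N)
    (R E : Matrix (Fin 2 × Fin 2 × Fin 2) (Fin 2 × Fin 2 × Fin 2) ℂ)
    (hR : R = -gYB 1 (Real.pi / N))
    (hE : E = 1 - (2 * Complex.I * (Real.sin (Real.pi / N) : ℂ))⁻¹ • (R - R⁻¹)) :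
    E * E = (2 : ℂ) • E ∧
      R * E = (-Complex.exp ((Real.pi / N : ℂ) * Complex.I)) • E := by
  have hN0 : (0 : ℝ) < N := by exact_mod_cast (by omega : 0 < N)
  have hsin : Real.sin (Real.pi / N) ≠ 0 :=
    (Real.sin_pos_of_pos_of_lt_pi (by positivity) (div_lt_self Real.pi_pos
      (by exact_mod_cast (by omega : 1 < N)))).ne'
  have hinv : R⁻¹ = -gYB 1 (-(Real.pi / N)) := by
    rw [hR]
    exact Matrix.inv_eq_right_inv (by rw [neg_mul_neg, gYB_mul_gYB_neg (one_pow 2)])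
  have hc : 2 * Complex.I * (Real.sin (Real.pi / N) : ℂ) ≠ 0 :=
    mul_ne_zero (mul_ne_zero two_ne_zero Complex.I_ne_zero) (Complex.ofReal_ne_zero.2 hsin)
  have hET : E = trivialChannel := by
    rw [hE, hinv, hR, neg_sub_neg, ← neg_sub (gYB 1 (Real.pi / N)), gYB_sub_gYB_neg, smul_neg, smul_smul,
      inv_mul_cancel₀ hc, one_smul]
    abel
  refine ⟨by rw [hET, trivialChannel_mul_self], ?_⟩
  rw [hET, hR, neg_mul, gYB_one_mul_trivialChannel, neg_smul]
  push_cast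
  rfl
end

section
/- Let R := R_{−1}(π/3) on (ℂ²)^{⊗3} ≅ ℂ⁸. Then R satisfies the cubic minimal-polynomial identity R³ + e^{iπ/3} R² − e^{−2iπ/3} R − e^{−iπ/3} I₈ = 0. -/
open Matrix

/-- The block-diagonal matrix on `(ℂ²)^{⊗3}` preserving the outer indices, which acts on the middle
one by `[[a,b],[b,a]]` if the outer indices agree and by `[[c,d],[d,c]]` otherwise. -/
def outerBlock (a b c d : ℂ) :
    Matrix (Fin 2 × Fin 2 × Fin 2) (Fin 2 × Fin 2 × Fin 2) ℂ :=
  Matrix.of fun p q =>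
    if p.1 = q.1 ∧ p.2.2 = q.2.2 then
      if p.1 = p.2.2 then
        if p.2.1 = q.2.1 then a else b
      else
        if p.2.1 = q.2.1 then c else d
    else 0

lemma gYB_eq_outerBlock (ν : ℂ) (θ : ℝ) :
    gYB ν θ = outerBlock (ν * (Real.cos θ : ℂ)) (Complex.I * (Real.sin θ : ℂ))
      (-(Complex.I * (Real.sin θ : ℂ))) (Real.cos θ : ℂ) :=
  rfl

lemma outerBlock_mul (a b c d a' b' c' d' : ℂ) :
    outerBlock a b c d * outerBlock a' b' c' d' =
      outerBlock (a * a' + b * b') (a * b' + b * a') (c * c' + d * d') (c * d' + d * c') := by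
  ext ⟨p₁, p₂, p₃⟩ ⟨q₁, q₂, q₃⟩
  fin_cases p₁ <;> fin_cases p₂ <;> fin_cases p₃ <;> fin_cases q₁ <;> fin_cases q₂ <;>
    fin_cases q₃ <;>
    simp [outerBlock, Matrix.mul_apply, Fintype.sum_prod_type, add_comm]

lemma outerBlock_add (a b c d a' b' c' d' : ℂ) :
    outerBlock a b c d + outerBlock a' b' c' d' =
      outerBlock (a + a') (b + b') (c + c') (d + d') := by
  ext p q
  simp only [outerBlock, Matrix.add_apply, Matrix.of_apply]
  split_ifs <;> simp

lemma outerBlock_sub (a b c d a' b' c' d' : ℂ) :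
    outerBlock a b c d - outerBlock a' b' c' d' =
      outerBlock (a - a') (b - b') (c - c') (d - d') := by
  ext p q
  simp only [outerBlock, Matrix.sub_apply, Matrix.of_apply]
  split_ifs <;> simp

lemma smul_outerBlock (z a b c d : ℂ) :
    z • outerBlock a b c d = outerBlock (z * a) (z * b) (z * c) (z * d) := by
  ext p q
  simp only [outerBlock, Matrix.smul_apply, Matrix.of_apply, smul_eq_mul]
  split_ifs <;> simp

lemma outerBlock_one : outerBlock 1 0 1 0 = 1 := by
  ext ⟨p₁, p₂, p₃⟩ ⟨q₁, q₂, q₃⟩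
  simp only [outerBlock, Matrix.of_apply, Matrix.one_apply, Prod.mk.injEq]
  split_ifs <;> first | rfl | tauto

lemma outerBlock_zero : outerBlock 0 0 0 0 = 0 := by
  ext p q
  simp [outerBlock]

lemma exp_mul_I_of_real (x : ℝ) :
    Complex.exp ((x : ℂ) * Complex.I) = (Real.cos x : ℂ) + (Real.sin x : ℂ) * Complex.I := by
  rw [Complex.exp_mul_I, Complex.ofReal_cos, Complex.ofReal_sin]

/-- `R := R_{−1}(π/3)` satisfies the cubic minimal-polynomial identity
`R³ + e^{iπ/3} R² − e^{−2iπ/3} R − e^{−iπ/3} I₈ = 0`. -/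
theorem stmt_11
    (R : Matrix (Fin 2 × Fin 2 × Fin 2) (Fin 2 × Fin 2 × Fin 2) ℂ)
    (hR : R = gYB (-1) (Real.pi / 3)) :
    R ^ 3 + Complex.exp ((Real.pi / 3 : ℂ) * Complex.I) • R ^ 2
        - Complex.exp (-(2 * (Real.pi : ℂ) / 3) * Complex.I) • R
        - Complex.exp (-(Real.pi / 3 : ℂ) * Complex.I) •
            (1 : Matrix (Fin 2 × Fin 2 × Fin 2) (Fin 2 × Fin 2 × Fin 2) ℂ) = 0 := by
  obtain ⟨s, hs, hsin⟩ : ∃ s : ℂ, s ^ 2 = 3 / 4 ∧ (Real.sin (Real.pi / 3) : ℂ) = s := by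
    refine ⟨_, ?_, rfl⟩
    have h : Real.sin (Real.pi / 3) ^ 2 = 3 / 4 := by
      rw [Real.sin_sq, Real.cos_pi_div_three]
      norm_num
    rw [← Complex.ofReal_pow, h]
    norm_num
  have hcos : (Real.cos (Real.pi / 3) : ℂ) = 1 / 2 := by
    rw [Real.cos_pi_div_three]
    norm_num
  have e₁ : Complex.exp ((Real.pi / 3 : ℂ) * Complex.I) = 1 / 2 + s * Complex.I := by
    rw [← hsin, ← hcos, ← exp_mul_I_of_real]
    push_cast
    rfl
  have e₂ : Complex.exp (-(Real.pi / 3 : ℂ) * Complex.I) = 1 / 2 - s * Complex.I := by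
    have h := exp_mul_I_of_real (-(Real.pi / 3))
    rw [Real.cos_neg, Real.sin_neg, hcos, Complex.ofReal_neg (Real.sin _), hsin] at h
    rw [Complex.ofReal_neg, Complex.ofReal_div, Complex.ofReal_ofNat] at h
    rw [h]
    ring
  have hI : Complex.I ^ 2 = -1 := Complex.I_sq
  have e₃ : Complex.exp (-(2 * (Real.pi : ℂ) / 3) * Complex.I) = -(1 / 2) - s * Complex.I := by
    have h : -(2 * (Real.pi : ℂ) / 3) * Complex.I =
        -(Real.pi / 3 : ℂ) * Complex.I + -(Real.pi / 3 : ℂ) * Complex.I := by ring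
    rw [h, Complex.exp_add, e₂]
    linear_combination s ^ 2 * hI - hs
  rw [e₁, e₂, e₃, hR, gYB_eq_outerBlock, hcos, hsin, pow_succ, sq, ← outerBlock_one]
  simp only [outerBlock_mul, outerBlock_add, outerBlock_sub, smul_outerBlock]
  rw [← outerBlock_zero]
  generalize Complex.I = i at hI
  congr 1 <;> grind
end

section
/- Let N ≥ 5 be an odd integer, R := −R_{+1}(π/N), α := e^{iπ(N−1)/N}, and fix an integer n ≥ 2. For 1 ≤ l ≤ n−1 let R_l := I₂^{⊗(l−1)} ⊗ R ⊗ I₂^{⊗(n−l−1)} on (ℂ²)^{⊗(n+1)}. Then for every element f of the subgroup of GL((ℂ²)^{⊗(n+1)}) generated by R₁,…,R_{n−1}: tr( (I₂^{⊗(n−1)} ⊗ (Sp_{3,1}(R) − α · I₄))* ∘ f ) = 0 and tr( (I₂^{⊗(n−1)} ⊗ (Sp_{3,1}(R^{−1}) − α^{−1} · I₄))* ∘ f ) = 0. (This is the enhancement condition making (R, μ = Id, α = θ_{X₁}, β = 1) an enhanced generalized Yang–Baxter operator.) -/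
open Matrix

/-- The operator on `(ℂ²)^{⊗n}` acting as the two-strand operator `M` on the tensor
factors at positions `p₁, p₂` and as the identity elsewhere; for the last two positions
this is the Kronecker product `I₂^{⊗(n−2)} ⊗ M`. -/
noncomputable def embed2 {n : ℕ} (p₁ p₂ : Fin n)
    (M : Matrix (Fin 2 × Fin 2) (Fin 2 × Fin 2) ℂ) :
    Matrix (Fin n → Fin 2) (Fin n → Fin 2) ℂ :=
  Matrix.of fun f g =>
    (if ∀ k, k ≠ p₁ → k ≠ p₂ → f k = g k then 1 else 0) * M (f p₁, f p₂) (g p₁, g p₂)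

/-- `-R_{+1}(θ)` is unitary. -/
lemma neg_gYB_one_mul_conjTranspose (θ : ℝ) : (-gYB 1 θ) * (-gYB 1 θ)ᴴ = 1 := by
  have hsc : (Complex.cos θ) ^ 2 + (Complex.sin θ) ^ 2 = 1 := Complex.cos_sq_add_sin_sq _
  ext ⟨a, b, c⟩ ⟨a', b', c'⟩
  simp only [Matrix.mul_apply, Fintype.sum_prod_type, Fin.sum_univ_two]
  fin_cases a <;> fin_cases b <;> fin_cases c <;> fin_cases a' <;> fin_cases b' <;>
    fin_cases c' <;>
    simp [gYB, ← Complex.cos_conj, ← Complex.sin_conj] <;>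
    first
    | ring1
    | linear_combination hsc - (Complex.sin θ) ^ 2 * Complex.I_sq

/-- The partial trace `Sp_{3,1}` commutes with the conjugate transpose. -/
lemma Sp31_conjTranspose (M : Matrix (Fin 2 × Fin 2 × Fin 2) (Fin 2 × Fin 2 × Fin 2) ℂ) :
    Sp31 Mᴴ = (Sp31 M)ᴴ := by
  ext p q
  simp [Sp31]

/-- The difference `Sp_{3,1}(-R_{+1}(θ)) + e^{-iθ}` has no entries preserving the second tensor
factor. -/
lemma Sp31_neg_gYB_one_sub_apply_eq_zero (θ : ℝ) {α : ℂ}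
    (hα : α = -Complex.exp (-(θ * Complex.I))) (p q : Fin 2 × Fin 2) (h : p.2 = q.2) :
    (Sp31 (-gYB 1 θ) - α • 1) p q = 0 := by
  obtain ⟨a, b⟩ := p
  obtain ⟨c, d⟩ := q
  obtain rfl : b = d := h
  have hexp : Complex.exp (-(θ * Complex.I)) =
      Complex.cos θ - Complex.sin θ * Complex.I := by
    rw [← neg_mul, Complex.exp_mul_I, Complex.cos_neg, Complex.sin_neg]
    ring
  rw [hα, hexp]
  fin_cases a <;> fin_cases c <;> simp [Sp31, gYB] <;> ring

/-- A matrix commutes with the diagonal matrix reading off the index at `k` as soon as its nonzero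
entries preserve that index. -/
lemma commute_diagonal_of_apply_eq_zero {m : ℕ} (k : Fin m)
    {M : Matrix (Fin m → Fin 2) (Fin m → Fin 2) ℂ}
    (h : ∀ a b, a k ≠ b k → M a b = 0) :
    Commute (Matrix.diagonal fun a : Fin m → Fin 2 => ((a k : ℕ) : ℂ)) M := by
  ext a b
  rw [Matrix.diagonal_mul, Matrix.mul_diagonal]
  by_cases hab : a k = b k
  · rw [hab, mul_comm]
  · simp [h a b hab]

/-- The nonzero entries of a matrix commuting with the diagonal matrix reading off the index at `k`
preserve that index. -/
lemma apply_eq_zero_of_commute_diagonal {m : ℕ} {k : Fin m}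
    {M : Matrix (Fin m → Fin 2) (Fin m → Fin 2) ℂ}
    (h : Commute (Matrix.diagonal fun a : Fin m → Fin 2 => ((a k : ℕ) : ℂ)) M)
    {a b : Fin m → Fin 2} (hab : a k ≠ b k) : M a b = 0 := by
  have hM := congrFun (congrFun h.eq a) b
  rw [Matrix.diagonal_mul, Matrix.mul_diagonal, mul_comm] at hM
  refine (mul_eq_mul_left_iff.mp hM).resolve_left fun hc => hab ?_
  exact Fin.ext (Nat.cast_injective hc)

/-- Entries of `embed3 p₁ p₂ p₃ (-R_{+1}(θ))` vanish unless the index at every `k ≠ p₂` is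
preserved. -/
lemma embed3_neg_gYB_apply_eq_zero {m : ℕ} (p₁ p₂ p₃ k : Fin m) (hk : k ≠ p₂) (θ : ℝ)
    (a b : Fin m → Fin 2) (hab : a k ≠ b k) : embed3 p₁ p₂ p₃ (-gYB 1 θ) a b = 0 := by
  simp only [embed3, Matrix.of_apply, mul_eq_zero, ite_eq_right_iff]
  by_cases h1 : k = p₁
  · subst h1
    simp [gYB, hab]
  by_cases h3 : k = p₃
  · subst h3
    simp [gYB, hab]
  exact Or.inl fun h => absurd (h k h1 hk h3) hab

/-- If `M` always changes the second tensor factor and `F` preserves the factor at `p₂`, then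
`embed2 p₁ p₂ M` is orthogonal to `F`. -/
lemma trace_embed2_conjTranspose_mul_eq_zero {m : ℕ} (p₁ p₂ : Fin m)
    {M : Matrix (Fin 2 × Fin 2) (Fin 2 × Fin 2) ℂ} (hM : ∀ p q, p.2 = q.2 → M p q = 0)
    {F : Matrix (Fin m → Fin 2) (Fin m → Fin 2) ℂ} (hF : ∀ a b, a p₂ ≠ b p₂ → F a b = 0) :
    ((embed2 p₁ p₂ M)ᴴ * F).trace = 0 := by
  refine Finset.sum_eq_zero fun a _ => Finset.sum_eq_zero fun b _ => ?_
  by_cases hab : b p₂ = a p₂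
  · simp [embed2, hM (b p₁, b p₂) (a p₁, a p₂) hab]
  · simp [hF b a hab]

/-- let `N ≥ 5` be odd, `R := −R_{+1}(π/N)`, `α := e^{iπ(N−1)/N}`, `n ≥ 2`,
and `R_l := I₂^{⊗(l−1)} ⊗ R ⊗ I₂^{⊗(n−l−1)}` on `(ℂ²)^{⊗(n+1)}` for `1 ≤ l ≤ n−1`.
Then every element `f` of the subgroup of `GL((ℂ²)^{⊗(n+1)})` generated by
`R₁, …, R_{n−1}` satisfies the enhancement (orthogonality) conditions
`tr((I₂^{⊗(n−1)} ⊗ (Sp_{3,1}(R) − α I₄))ᴴ * f) = 0` and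
`tr((I₂^{⊗(n−1)} ⊗ (Sp_{3,1}(R⁻¹) − α⁻¹ I₄))ᴴ * f) = 0`. -/
theorem stmt_13 (N : ℕ) (hN : 5 ≤ N) (hodd : Odd N) (n : ℕ) (hn : 2 ≤ n)
    (R : Matrix (Fin 2 × Fin 2 × Fin 2) (Fin 2 × Fin 2 × Fin 2) ℂ)
    (hR : R = -gYB 1 (Real.pi / N))
    (α : ℂ) (hα : α = Complex.exp (Real.pi * ((N : ℂ) - 1) / N * Complex.I))
    (f : (Matrix (Fin (n + 1) → Fin 2) (Fin (n + 1) → Fin 2) ℂ)ˣ)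
    (hf : f ∈ Subgroup.closure
      {u : (Matrix (Fin (n + 1) → Fin 2) (Fin (n + 1) → Fin 2) ℂ)ˣ |
        ∃ l, ∃ (h1 : 1 ≤ l) (h2 : l < n),
          (u : Matrix (Fin (n + 1) → Fin 2) (Fin (n + 1) → Fin 2) ℂ) =
            embed3 ⟨l - 1, by omega⟩ ⟨l, by omega⟩ ⟨l + 1, by omega⟩ R}) :
    ((embed2 (⟨n - 1, by omega⟩ : Fin (n + 1)) ⟨n, by omega⟩ (Sp31 R - α • 1))ᴴ *
        (f : Matrix (Fin (n + 1) → Fin 2) (Fin (n + 1) → Fin 2) ℂ)).trace = 0 ∧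
      ((embed2 (⟨n - 1, by omega⟩ : Fin (n + 1)) ⟨n, by omega⟩ (Sp31 (R⁻¹) - α⁻¹ • 1))ᴴ *
        (f : Matrix (Fin (n + 1) → Fin 2) (Fin (n + 1) → Fin 2) ℂ)).trace = 0 := by
  have hN0 : (N : ℂ) ≠ 0 := by
    exact_mod_cast (by omega : N ≠ 0)
  have hα' : α = -Complex.exp (-(((Real.pi / N : ℝ) : ℂ) * Complex.I)) := by
    rw [hα, ← neg_one_mul, ← Complex.exp_pi_mul_I, ← Complex.exp_add]
    congr 1
    push_cast
    field_simp
    ring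
  have hinv : α⁻¹ = star α := by
    rw [hα', inv_neg, ← Complex.exp_neg, star_neg, ← starRingEnd_apply, ← Complex.exp_conj]
    simp
  have hRinv : R⁻¹ = Rᴴ := by
    rw [hR]
    exact Matrix.inv_eq_right_inv (neg_gYB_one_mul_conjTranspose _)
  have hsub : ∀ p q : Fin 2 × Fin 2, p.2 = q.2 → (Sp31 R - α • 1) p q = 0 := by
    rw [hR]
    exact Sp31_neg_gYB_one_sub_apply_eq_zero _ hα'
  have hsub' : ∀ p q : Fin 2 × Fin 2, p.2 = q.2 → (Sp31 R⁻¹ - α⁻¹ • 1) p q = 0 := by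
    intro p q hpq
    have hconj : Sp31 R⁻¹ - α⁻¹ • 1 = (Sp31 R - α • 1)ᴴ := by
      rw [hRinv, hinv, Sp31_conjTranspose, Matrix.conjTranspose_sub, Matrix.conjTranspose_smul,
        Matrix.conjTranspose_one]
    rw [hconj, Matrix.conjTranspose_apply, hsub q p hpq.symm, star_zero]
  have hcomm : Commute (Matrix.diagonal fun a : Fin (n + 1) → Fin 2 =>
      ((a ⟨n, by omega⟩ : ℕ) : ℂ)) (f : Matrix (Fin (n + 1) → Fin 2) (Fin (n + 1) → Fin 2) ℂ) := by
    induction hf using Subgroup.closure_induction with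
    | mem u hu =>
      obtain ⟨l, h1, h2, hu⟩ := hu
      rw [hu, hR]
      refine commute_diagonal_of_apply_eq_zero _ (embed3_neg_gYB_apply_eq_zero _ _ _ _ ?_ _)
      simp only [ne_eq, Fin.mk.injEq]
      omega
    | one => exact Commute.one_right _
    | mul u v _ _ hu hv => exact hu.mul_right hv
    | inv u _ hu => exact hu.units_inv_right
  have hF := fun (a b : Fin (n + 1) → Fin 2) (hab : a ⟨n, by omega⟩ ≠ b ⟨n, by omega⟩) =>
    apply_eq_zero_of_commute_diagonal hcomm hab
  exact ⟨trace_embed2_conjTranspose_mul_eq_zero _ _ hsub hF,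
    trace_embed2_conjTranspose_mul_eq_zero _ _ hsub' hF⟩
end
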